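/- arXiv:1806.11079 — 10 statements merged into one kernel-verified Lean document; each statement's English description precedes it below -/
import Mathlib

section
/- Let F be a field of characteristic ≠ 2 containing an element s with s² = 5, set ε₁ = (-11+5s)/2 (so ε₁ = ε⁵ for ε = (-1+s)/2), and define τ(b) = (-b + ε₁)/(ε₁·b + 1). If b ∈ F satisfies b ≠ 0, ε₁·b + 1 ≠ 0, τ(b) ≠ 0, and b² + 11b - 1 ≠ 0, then with z = b - 1/b one has τ(b) - 1/τ(b) = (-11z + 4)/(z + 11). -/
/-- Identity from the proof of Proposition 4.1: with `τ(b) = (-b + ε₁)/(ε₁b + 1)`,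
`ε₁ = ε⁵ = (-11 + 5√5)/2`, and `z = b - 1/b`, one has
`τ(b) - 1/τ(b) = (-11z + 4)/(z + 11)`. -/
theorem tau_sub_inv_tau {F : Type*} [Field F] (h2 : (2 : F) ≠ 0)
    (s : F) (hs : s ^ 2 = 5) (ε₁ : F) (hε₁ : ε₁ = (-11 + 5 * s) / 2)
    (b : F) (hb : b ≠ 0) (hden : ε₁ * b + 1 ≠ 0)
    (τb : F) (hτ : τb = (-b + ε₁) / (ε₁ * b + 1)) (hτ0 : τb ≠ 0)
    (hq : b ^ 2 + 11 * b - 1 ≠ 0) :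
    τb - 1 / τb = (-11 * (b - 1 / b) + 4) / ((b - 1 / b) + 11) := by
  have hE : ε₁ ^ 2 + 11 * ε₁ - 1 = 0 := by
    have h : 2 * ε₁ = -11 + 5 * s := by rw [hε₁]; field_simp
    have h4 : (2 * 2 : F) * (ε₁ ^ 2 + 11 * ε₁ - 1) = 0 := by
      linear_combination (2 * ε₁ + 11 + 5 * s) * h + 25 * hs
    exact (mul_eq_zero.mp h4).resolve_left (mul_ne_zero h2 h2)
  have hnum : -b + ε₁ ≠ 0 := fun h => hτ0 (by rw [hτ, h, zero_div])
  have hL : τb - 1 / τb =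
      ((-b + ε₁) ^ 2 - (ε₁ * b + 1) ^ 2) / ((ε₁ * b + 1) * (-b + ε₁)) := by
    rw [hτ]
    field_simp
  have hR : (-11 * (b - 1 / b) + 4) / ((b - 1 / b) + 11) =
      (-11 * (b ^ 2 - 1) + 4 * b) / (b ^ 2 + 11 * b - 1) := by
    have hn : -11 * (b - 1 / b) + 4 = (-11 * (b ^ 2 - 1) + 4 * b) / b := by
      field_simp
    have hd : (b - 1 / b) + 11 = (b ^ 2 + 11 * b - 1) / b := by
      field_simp
      ring
    rw [hn, hd, div_div_div_cancel_right₀ hb]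
  rw [hL, hR, div_eq_div_iff (mul_ne_zero hden hnum) hq]
  linear_combination
    ((1 - b ^ 2) * (b ^ 2 + 11 * b - 1) + (11 * b ^ 2 - 4 * b - 11) * b) * hE
end

section
/- Let F be a field of characteristic ≠ 5, and define the rational functions J₁(z) = -(z² + 12z + 16)³/(z + 11) and J₂(z) = -(z² - 228z + 496)³/(z + 11)⁵, and the linear fractional map V(z) = (-11z + 4)/(z + 11). Then for every z ∈ F with z ≠ -11 one has V(z) ≠ -11, J₁(V(z)) = J₂(z), and J₂(V(z)) = J₁(z); moreover V(V(z)) = z, so V is an involution. -/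
/-- The `j`-invariant `j₅(b)` of `E₅(b)` as a function of `z = b - 1/b`. -/
noncomputable def J₁ {F : Type*} [Field F] (z : F) : F :=
  -(z ^ 2 + 12 * z + 16) ^ 3 / (z + 11)

/-- The `j`-invariant `j₅,₅(b)` of `E₅,₅(b)` as a function of `z = b - 1/b`. -/
noncomputable def J₂ {F : Type*} [Field F] (z : F) : F :=
  -(z ^ 2 - 228 * z + 496) ^ 3 / (z + 11) ^ 5

/-- The linear fractional map `V(z) = (-11z + 4)/(z + 11)`. -/
noncomputable def V {F : Type*} [Field F] (z : F) : F :=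
  (-11 * z + 4) / (z + 11)

theorem V_add_eleven {F : Type*} [Field F] {z : F} (hz : z + 11 ≠ 0) :
    V z + 11 = 125 / (z + 11) := by
  unfold V
  field_simp
  ring

theorem J₁_eq {F : Type*} [Field F] (z : F) :
    J₁ z = -((z + 11) ^ 2 - 10 * (z + 11) + 5) ^ 3 / (z + 11) := by
  unfold J₁
  ring

theorem J₂_eq {F : Type*} [Field F] (z : F) :
    J₂ z = -((z + 11) ^ 2 - 250 * (z + 11) + 3125) ^ 3 / (z + 11) ^ 5 := by
  unfold J₂
  ring

/-- Corollary 4.2 of the paper: the involution `V` interchanges `J₁` and `J₂`. -/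
theorem V_swaps_J₁_J₂ {F : Type*} [Field F] (h5 : (5 : F) ≠ 0)
    (z : F) (hz : z ≠ -11) :
    V z ≠ -11 ∧ J₁ (V z) = J₂ z ∧ J₂ (V z) = J₁ z ∧ V (V z) = z := by
  have hw : z + 11 ≠ 0 := fun h => hz (eq_neg_of_add_eq_zero_left h)
  have h125 : (125 : F) ≠ 0 := by
    have h : (125 : F) = 5 ^ 3 := by norm_num
    rw [h]
    exact pow_ne_zero 3 h5
  have hV := V_add_eleven hw
  have hVw : V z + 11 ≠ 0 := hV ▸ div_ne_zero h125 hw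
  refine ⟨fun h => hVw (by rw [h, neg_add_cancel]), ?_, ?_, ?_⟩
  · rw [J₁_eq, J₂_eq, hV]
    generalize z + 11 = w at hw
    field_simp
    ring
  · rw [J₁_eq, J₂_eq, hV]
    generalize z + 11 = w at hw
    field_simp
    ring
  · apply add_right_cancel (b := (11 : F))
    rw [V_add_eleven hVw, hV, div_div_cancel₀ h125]
end

section
/- Let F be a field and b ∈ F with b ≠ 0 and b² + 11b - 1 ≠ 0. Then with z = b - 1/b one has the identity (1 - 12b + 14b² + 12b³ + b⁴)³/(b⁵(1 - 11b - b²)) = -(z² + 12z + 16)³/(z + 11). -/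
/-- Equation (1.5) of the paper: the `j`-invariant `j₅(b)` of the Tate normal form
`E₅(b)` in terms of `z = b - 1/b`. -/
theorem j₅_in_terms_of_z {F : Type*} [Field F] (b : F) (hb : b ≠ 0)
    (hq : b ^ 2 + 11 * b - 1 ≠ 0) :
    (1 - 12 * b + 14 * b ^ 2 + 12 * b ^ 3 + b ^ 4) ^ 3 / (b ^ 5 * (1 - 11 * b - b ^ 2))
      = -((b - 1 / b) ^ 2 + 12 * (b - 1 / b) + 16) ^ 3 / ((b - 1 / b) + 11) := by
  have hnum : (b - 1 / b) ^ 2 + 12 * (b - 1 / b) + 16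
      = (1 - 12 * b + 14 * b ^ 2 + 12 * b ^ 3 + b ^ 4) / b ^ 2 := by
    field_simp
    ring
  have hden : b - 1 / b + 11 = (b ^ 2 + 11 * b - 1) / b := by
    field_simp
    ring
  have hneg : 1 - 11 * b - b ^ 2 = -(b ^ 2 + 11 * b - 1) := by ring
  rw [hnum, hden, hneg]
  generalize b ^ 2 + 11 * b - 1 = q at hq
  field_simp
end

section
/- Let F be a field and b ∈ F with b ≠ 0 and b² + 11b - 1 ≠ 0. Then with z = b - 1/b one has the identity (1 + 228b + 494b² - 228b³ + b⁴)³/(b(1 - 11b - b²)⁵) = -(z² - 228z + 496)³/(z + 11)⁵. -/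
/-- Equation (2.2a,b) of the paper: the `j`-invariant `j₅,₅(b)` of the curve
`E₅,₅(b)` in terms of `z = b - 1/b`. -/
theorem j₅₅_in_terms_of_z {F : Type*} [Field F] (b : F) (hb : b ≠ 0)
    (hq : b ^ 2 + 11 * b - 1 ≠ 0) :
    (1 + 228 * b + 494 * b ^ 2 - 228 * b ^ 3 + b ^ 4) ^ 3 / (b * (1 - 11 * b - b ^ 2) ^ 5)
      = -((b - 1 / b) ^ 2 - 228 * (b - 1 / b) + 496) ^ 3 / ((b - 1 / b) + 11) ^ 5 := by
  have hz : (b - 1 / b) + 11 = (b ^ 2 + 11 * b - 1) / b := by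
    field_simp
    ring
  have hnum : (b - 1 / b) ^ 2 - 228 * (b - 1 / b) + 496
      = (1 + 228 * b + 494 * b ^ 2 - 228 * b ^ 3 + b ^ 4) / b ^ 2 := by
    field_simp
    ring
  have hden : 1 - 11 * b - b ^ 2 = -(b ^ 2 + 11 * b - 1) := by ring
  rw [hz, hnum, hden]
  generalize b ^ 2 + 11 * b - 1 = q at hq ⊢
  generalize 1 + 228 * b + 494 * b ^ 2 - 228 * b ^ 3 + b ^ 4 = n
  rw [Odd.neg_pow (by decide)]
  field_simp
end

section
/- Let F be a field and b ∈ F with b(1 - 11b - b²) ≠ 0. Then the Weierstrass curve E₅,₅(b) with coefficients a₁ = 1 + b, a₂ = 7b, a₃ = 5b, a₄ = 6b³ + 6b² - 6b, a₆ = b⁵ + b⁴ - 10b³ - 29b² - b has discriminant Δ = b(1 - 11b - b²)⁵, is therefore an elliptic curve over F, and its j-invariant equals (1 + 228b + 494b² - 228b³ + b⁴)³/(b(1 - 11b - b²)⁵). -/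
/-- Equation (2.2a) of the paper: the curve
`E₅,₅(b) : Y² + (1+b)XY + 5bY = X³ + 7bX² + (6b³+6b²-6b)X + b⁵+b⁴-10b³-29b²-b`
has discriminant `b(1 - 11b - b²)⁵`, hence is an elliptic curve when
`b(1 - 11b - b²) ≠ 0`, with `j`-invariant
`(1 + 228b + 494b² - 228b³ + b⁴)³/(b(1 - 11b - b²)⁵)`. -/
theorem E₅₅_discriminant_isElliptic_and_j {F : Type*} [Field F] (b : F)
    (h : b * (1 - 11 * b - b ^ 2) ≠ 0) :
    (⟨1 + b, 7 * b, 5 * b, 6 * b ^ 3 + 6 * b ^ 2 - 6 * b,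
        b ^ 5 + b ^ 4 - 10 * b ^ 3 - 29 * b ^ 2 - b⟩ : WeierstrassCurve F).Δ
        = b * (1 - 11 * b - b ^ 2) ^ 5 ∧
    ∃ hE : (⟨1 + b, 7 * b, 5 * b, 6 * b ^ 3 + 6 * b ^ 2 - 6 * b,
        b ^ 5 + b ^ 4 - 10 * b ^ 3 - 29 * b ^ 2 - b⟩ : WeierstrassCurve F).IsElliptic,
      @WeierstrassCurve.j F _ ⟨1 + b, 7 * b, 5 * b, 6 * b ^ 3 + 6 * b ^ 2 - 6 * b,
          b ^ 5 + b ^ 4 - 10 * b ^ 3 - 29 * b ^ 2 - b⟩ hE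
        = (1 + 228 * b + 494 * b ^ 2 - 228 * b ^ 3 + b ^ 4) ^ 3
            / (b * (1 - 11 * b - b ^ 2) ^ 5) := by
  have hΔ : (⟨1 + b, 7 * b, 5 * b, 6 * b ^ 3 + 6 * b ^ 2 - 6 * b,
      b ^ 5 + b ^ 4 - 10 * b ^ 3 - 29 * b ^ 2 - b⟩ : WeierstrassCurve F).Δ
      = b * (1 - 11 * b - b ^ 2) ^ 5 := by
    simp only [WeierstrassCurve.Δ, WeierstrassCurve.b₂, WeierstrassCurve.b₄,
      WeierstrassCurve.b₆, WeierstrassCurve.b₈]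
    ring
  have hne : b * (1 - 11 * b - b ^ 2) ^ 5 ≠ 0 :=
    mul_ne_zero (left_ne_zero_of_mul h) (pow_ne_zero 5 (right_ne_zero_of_mul h))
  refine ⟨hΔ, ⟨by rw [hΔ]; exact hne.isUnit⟩, ?_⟩
  rw [WeierstrassCurve.j, Units.val_inv_eq_inv_val, WeierstrassCurve.coe_Δ', hΔ, div_eq_inv_mul]
  congr 2
  simp only [WeierstrassCurve.c₄, WeierstrassCurve.b₂, WeierstrassCurve.b₄]
  ring
end

section
/- Let F be a field of characteristic ≠ 2, 5 containing an element s with s² = 5, and define T(z) = (-(1+s)z + 2)/(2z + 1 + s) and f₅(z) = (1 + 228z⁵ + 494z¹⁰ - 228z¹⁵ + z²⁰)³/(z⁵(1 - 11z⁵ - z¹⁰)⁵). Then for every z ∈ F such that z ≠ 0, 1 - 11z⁵ - z¹⁰ ≠ 0, 2z + 1 + s ≠ 0, T(z) ≠ 0, and 1 - 11T(z)⁵ - T(z)¹⁰ ≠ 0, one has f₅(T(z)) = f₅(z). -/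
/-- The icosahedral invariant
`f₅(z) = (1 + 228z⁵ + 494z¹⁰ - 228z¹⁵ + z²⁰)³/(z⁵(1 - 11z⁵ - z¹⁰)⁵)`. -/
noncomputable def f₅ {F : Type*} [Field F] (z : F) : F :=
  (1 + 228 * z ^ 5 + 494 * z ^ 10 - 228 * z ^ 15 + z ^ 20) ^ 3
    / (z ^ 5 * (1 - 11 * z ^ 5 - z ^ 10) ^ 5)

/-- The generator `T(z) = (-(1+√5)z + 2)/(2z + 1 + √5)` of the icosahedral group. -/
noncomputable def T {F : Type*} [Field F] (s : F) (z : F) : F :=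
  (-(1 + s) * z + 2) / (2 * z + 1 + s)

section IcosahedralForms

variable {R : Type*} [CommRing R] {g : R}

/-- Powers of the golden ratio are linear in it, with Fibonacci coefficients. -/
theorem golden_pow (hg : g ^ 2 = g + 1) (n : ℕ) :
    g ^ (n + 1) = Nat.fib (n + 1) * g + Nat.fib n := by
  induction n with
  | zero => simp
  | succ n ih =>
    rw [pow_succ, ih, Nat.fib_add_two]
    push_cast
    linear_combination (Nat.fib (n + 1) : R) * hg

theorem golden_one_sub_mul_pow_five (hg : g ^ 2 = g + 1) (z : R) :
    (1 - g * z) ^ 5 = 1 - 5 * g * z + 10 * (g + 1) * z ^ 2 - 10 * (2 * g + 1) * z ^ 3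
      + 5 * (3 * g + 2) * z ^ 4 - (5 * g + 3) * z ^ 5 := by
  have h3 : g ^ 3 = 2 * g + 1 := by simpa [Nat.fib_add_two] using golden_pow hg 2
  have h4 : g ^ 4 = 3 * g + 2 := by simpa [Nat.fib_add_two] using golden_pow hg 3
  have h5 : g ^ 5 = 5 * g + 3 := by simpa [Nat.fib_add_two] using golden_pow hg 4
  linear_combination 10 * z ^ 2 * hg - 10 * z ^ 3 * h3 + 5 * z ^ 4 * h4 - z ^ 5 * h5

theorem golden_add_pow_five (hg : g ^ 2 = g + 1) (z : R) :
    (z + g) ^ 5 = z ^ 5 + 5 * g * z ^ 4 + 10 * (g + 1) * z ^ 3 + 10 * (2 * g + 1) * z ^ 2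
      + 5 * (3 * g + 2) * z + (5 * g + 3) := by
  have h3 : g ^ 3 = 2 * g + 1 := by simpa [Nat.fib_add_two] using golden_pow hg 2
  have h4 : g ^ 4 = 3 * g + 2 := by simpa [Nat.fib_add_two] using golden_pow hg 3
  have h5 : g ^ 5 = 5 * g + 3 := by simpa [Nat.fib_add_two] using golden_pow hg 4
  linear_combination 10 * z ^ 3 * hg + 10 * z ^ 2 * h3 + 5 * z * h4 + h5

/-- The form of degree 12 vanishing at the vertices of the icosahedron is semi-invariant. -/
theorem icosahedral_vertex_form (hg : g ^ 2 = g + 1) (z : R) :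
    (1 - g * z) * (z + g) * (((z + g) ^ 5) ^ 2 - 11 * (1 - g * z) ^ 5 * (z + g) ^ 5
      - ((1 - g * z) ^ 5) ^ 2) = (g + 2) ^ 6 * (z * (1 - 11 * z ^ 5 - z ^ 10)) := by
  have h3 : g ^ 3 = 2 * g + 1 := by simpa [Nat.fib_add_two] using golden_pow hg 2
  have h4 : g ^ 4 = 3 * g + 2 := by simpa [Nat.fib_add_two] using golden_pow hg 3
  have hk : (g + 2) ^ 6 = 125 * (8 * g + 5) := by
    have h5 : g ^ 5 = 5 * g + 3 := by simpa [Nat.fib_add_two] using golden_pow hg 4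
    have h6 : g ^ 6 = 8 * g + 5 := by simpa [Nat.fib_add_two] using golden_pow hg 5
    linear_combination h6 + 12 * h5 + 60 * h4 + 160 * h3 + 240 * hg
  rw [golden_one_sub_mul_pow_five hg, golden_add_pow_five hg, hk]
  ring_nf
  simp only [hg, h3, h4]
  ring

/-- The form of degree 20 vanishing at the face centers of the icosahedron is semi-invariant. -/
theorem icosahedral_face_form (hg : g ^ 2 = g + 1) (z : R) :
    ((z + g) ^ 5) ^ 4 + 228 * (1 - g * z) ^ 5 * ((z + g) ^ 5) ^ 3
      + 494 * ((1 - g * z) ^ 5) ^ 2 * ((z + g) ^ 5) ^ 2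
      - 228 * ((1 - g * z) ^ 5) ^ 3 * (z + g) ^ 5 + ((1 - g * z) ^ 5) ^ 4
      = (g + 2) ^ 10 * (1 + 228 * z ^ 5 + 494 * z ^ 10 - 228 * z ^ 15 + z ^ 20) := by
  have h3 : g ^ 3 = 2 * g + 1 := by simpa [Nat.fib_add_two] using golden_pow hg 2
  have h4 : g ^ 4 = 3 * g + 2 := by simpa [Nat.fib_add_two] using golden_pow hg 3
  have hk : (g + 2) ^ 10 = 3125 * (55 * g + 34) := by
    have hk2 : (g + 2) ^ 2 = 5 * g ^ 2 := by linear_combination (-4) * hg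
    have h10 : g ^ 10 = 55 * g + 34 := by simpa [Nat.fib_add_two] using golden_pow hg 9
    calc (g + 2) ^ 10 = ((g + 2) ^ 2) ^ 5 := by ring
      _ = 3125 * g ^ 10 := by rw [hk2]; ring
      _ = _ := by rw [h10]
  rw [golden_one_sub_mul_pow_five hg, golden_add_pow_five hg, hk]
  ring_nf
  simp only [hg, h3, h4]
  ring

end IcosahedralForms

/-- `f₅` at a quotient, in homogeneous coordinates. -/
theorem f₅_div {F : Type*} [Field F] (a : F) {b : F} (hb : b ≠ 0) :
    f₅ (a / b) = ((b ^ 5) ^ 4 + 228 * a ^ 5 * (b ^ 5) ^ 3 + 494 * (a ^ 5) ^ 2 * (b ^ 5) ^ 2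
      - 228 * (a ^ 5) ^ 3 * b ^ 5 + (a ^ 5) ^ 4) ^ 3
      / (a * b * ((b ^ 5) ^ 2 - 11 * a ^ 5 * b ^ 5 - (a ^ 5) ^ 2)) ^ 5 := by
  have hnum : 1 + 228 * (a / b) ^ 5 + 494 * (a / b) ^ 10 - 228 * (a / b) ^ 15 + (a / b) ^ 20
      = ((b ^ 5) ^ 4 + 228 * a ^ 5 * (b ^ 5) ^ 3 + 494 * (a ^ 5) ^ 2 * (b ^ 5) ^ 2
        - 228 * (a ^ 5) ^ 3 * b ^ 5 + (a ^ 5) ^ 4) / b ^ 20 := by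
    field_simp
  have hden : (a / b) ^ 5 * (1 - 11 * (a / b) ^ 5 - (a / b) ^ 10) ^ 5
      = (a * b * ((b ^ 5) ^ 2 - 11 * a ^ 5 * b ^ 5 - (a ^ 5) ^ 2)) ^ 5 / b ^ 60 := by
    have h : 1 - 11 * (a / b) ^ 5 - (a / b) ^ 10
        = ((b ^ 5) ^ 2 - 11 * a ^ 5 * b ^ 5 - (a ^ 5) ^ 2) / b ^ 10 := by
      field_simp
    rw [h]
    field_simp
  rw [f₅, hnum, hden, div_pow, ← pow_mul b 20 3, div_div_div_cancel_right₀ (pow_ne_zero _ hb)]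

/-- Section 5 of the paper: `f₅` is invariant under the substitution `T`. -/
theorem f₅_invariant_under_T {F : Type*} [Field F] (h2 : (2 : F) ≠ 0)
    (h5 : (5 : F) ≠ 0) (s : F) (hs : s ^ 2 = 5) (z : F)
    (hz0 : z ≠ 0) (hz1 : 1 - 11 * z ^ 5 - z ^ 10 ≠ 0)
    (hden : 2 * z + 1 + s ≠ 0) (hT0 : T s z ≠ 0)
    (hT1 : 1 - 11 * (T s z) ^ 5 - (T s z) ^ 10 ≠ 0) :
    f₅ (T s z) = f₅ z := by
  obtain ⟨g, rfl⟩ : ∃ g : F, s = 2 * g - 1 := ⟨(s + 1) / 2, by field_simp; ring⟩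
  have hg : g ^ 2 = g + 1 := by
    have h4 : (2 * 2 : F) ≠ 0 := mul_ne_zero h2 h2
    apply mul_left_cancel₀ h4
    linear_combination hs
  have hb : z + g ≠ 0 := by
    intro h
    apply hden
    linear_combination 2 * h
  have hk : g + 2 ≠ 0 := by
    intro h
    apply h5
    linear_combination (3 - g) * h + hg
  have hT : T (2 * g - 1) z = (1 - g * z) / (z + g) := by
    rw [T, div_eq_div_iff hden hb]
    ring
  rw [hT, f₅_div _ hb, icosahedral_vertex_form hg, icosahedral_face_form hg, mul_pow, mul_pow,
    ← pow_mul, ← pow_mul, mul_div_mul_left _ _ (pow_ne_zero _ hk), mul_pow, f₅]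
end

section
/- Let F be a field and define f₅(z) = (1 + 228z⁵ + 494z¹⁰ - 228z¹⁵ + z²⁰)³/(z⁵(1 - 11z⁵ - z¹⁰)⁵). Then for every z ∈ F with z ≠ 0 and 1 - 11z⁵ - z¹⁰ ≠ 0, the element U(z) = -1/z also satisfies 1 - 11U(z)⁵ - U(z)¹⁰ ≠ 0, and f₅(-1/z) = f₅(z). -/
/-- Section 5 of the paper: `f₅` is invariant under the substitution `U(z) = -1/z`. -/
theorem f₅_invariant_under_U {F : Type*} [Field F] (z : F)
    (hz0 : z ≠ 0) (hz1 : 1 - 11 * z ^ 5 - z ^ 10 ≠ 0) :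
    1 - 11 * (-1 / z) ^ 5 - (-1 / z) ^ 10 ≠ 0 ∧ f₅ (-1 / z) = f₅ z := by
  have hD : 1 - 11 * (-1 / z) ^ 5 - (-1 / z) ^ 10 = -(1 - 11 * z ^ 5 - z ^ 10) / z ^ 10 := by
    field_simp
    ring
  have hN : 1 + 228 * (-1 / z) ^ 5 + 494 * (-1 / z) ^ 10 - 228 * (-1 / z) ^ 15 + (-1 / z) ^ 20
      = (1 + 228 * z ^ 5 + 494 * z ^ 10 - 228 * z ^ 15 + z ^ 20) / z ^ 20 := by
    field_simp
    ring
  refine ⟨?_, ?_⟩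
  · rw [hD]
    exact div_ne_zero (neg_ne_zero.mpr hz1) (pow_ne_zero _ hz0)
  · unfold f₅
    rw [hD, hN]
    generalize 1 + 228 * z ^ 5 + 494 * z ^ 10 - 228 * z ^ 15 + z ^ 20 = N
    generalize 1 - 11 * z ^ 5 - z ^ 10 = D at hz1
    rw [div_pow, div_pow, div_pow, Odd.neg_pow (by decide), Odd.neg_pow (by decide)]
    field_simp
end

section
/- Let K = ℚ(ζ) where ζ is a primitive 20th root of unity, and set α₁ = -3ζ⁷ - ζ⁶ + ζ⁴ + 3ζ³ - 4, α₂ = 3ζ⁷ + ζ⁶ - 3ζ⁵ - ζ⁴ + 3ζ³ - 6ζ - 5, α₃ = 3ζ⁷ - ζ⁶ + ζ⁴ - 3ζ³ - 4, α₄ = -3ζ⁷ + ζ⁶ + 3ζ⁵ - ζ⁴ - 3ζ³ + 6ζ - 5. Then each of α₁, α₂, α₃, α₄ is a root of f₄(x) = x⁴ + 18x³ + 74x² - 18x + 1, and the relations α₁·α₂² = (-ζ⁷ - ζ⁶ + ζ⁴ + ζ³)⁵, α₁·α₃ = -1, and α₁·α₄³ = (2ζ⁷ - 2ζ⁶ -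 ζ⁵ + 2ζ⁴ - 2ζ + 2)⁵ hold in K. -/
open Polynomial

/-- A primitive 20th root of unity is a root of the cyclotomic polynomial
`Φ₂₀ = x⁸ - x⁶ + x⁴ - x² + 1`. -/
theorem IsPrimitiveRoot.cyclotomic_twenty_eq_zero {R : Type*} [CommRing R] [IsDomain R]
    {ζ : R} (hζ : IsPrimitiveRoot ζ 20) : ζ ^ 8 - ζ ^ 6 + ζ ^ 4 - ζ ^ 2 + 1 = 0 := by
  have h10 : ζ ^ 10 - 1 ≠ 0 :=
    sub_ne_zero.mpr (hζ.pow_ne_one_of_pos_of_lt (by norm_num) (by norm_num))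
  have h4 : ζ ^ 2 + 1 ≠ 0 := fun h =>
    hζ.pow_ne_one_of_pos_of_lt (l := 4) (by norm_num) (by norm_num)
      (by linear_combination (ζ ^ 2 - 1) * h)
  refine (mul_eq_zero.mp ((mul_eq_zero.mp ?_).resolve_left h10)).resolve_left h4
  linear_combination hζ.pow_eq_one

/-- Identities in the 20th cyclotomic field from the proof of Theorem 5.2 of the
paper (case `d = 4`): the four elements `α₁, α₂, α₃, α₄` are roots of
`f₄(x) = x⁴ + 18x³ + 74x² - 18x + 1`, and satisfy the displayed multiplicative
relations showing they agree up to fifth powers. -/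
theorem alpha_relations_in_cyclotomic_20 {K : Type*} [Field K] [Algebra ℚ K]
    [IsCyclotomicExtension {20} ℚ K] (ζ : K) (hζ : IsPrimitiveRoot ζ 20)
    (α₁ α₂ α₃ α₄ : K)
    (h₁ : α₁ = -3 * ζ ^ 7 - ζ ^ 6 + ζ ^ 4 + 3 * ζ ^ 3 - 4)
    (h₂ : α₂ = 3 * ζ ^ 7 + ζ ^ 6 - 3 * ζ ^ 5 - ζ ^ 4 + 3 * ζ ^ 3 - 6 * ζ - 5)
    (h₃ : α₃ = 3 * ζ ^ 7 - ζ ^ 6 + ζ ^ 4 - 3 * ζ ^ 3 - 4)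
    (h₄ : α₄ = -3 * ζ ^ 7 + ζ ^ 6 + 3 * ζ ^ 5 - ζ ^ 4 - 3 * ζ ^ 3 + 6 * ζ - 5) :
    ((X ^ 4 + 18 * X ^ 3 + 74 * X ^ 2 - 18 * X + 1 : K[X]).IsRoot α₁) ∧
    ((X ^ 4 + 18 * X ^ 3 + 74 * X ^ 2 - 18 * X + 1 : K[X]).IsRoot α₂) ∧
    ((X ^ 4 + 18 * X ^ 3 + 74 * X ^ 2 - 18 * X + 1 : K[X]).IsRoot α₃) ∧
    ((X ^ 4 + 18 * X ^ 3 + 74 * X ^ 2 - 18 * X + 1 : K[X]).IsRoot α₄) ∧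
    α₁ * α₂ ^ 2 = (-ζ ^ 7 - ζ ^ 6 + ζ ^ 4 + ζ ^ 3) ^ 5 ∧
    α₁ * α₃ = -1 ∧
    α₁ * α₄ ^ 3 = (2 * ζ ^ 7 - 2 * ζ ^ 6 - ζ ^ 5 + 2 * ζ ^ 4 - 2 * ζ + 2) ^ 5 := by
  have hΦ := hζ.cyclotomic_twenty_eq_zero
  subst h₁ h₂ h₃ h₄
  simp only [IsRoot.def, eval_add, eval_sub, eval_mul, eval_pow, eval_X, eval_one,
    eval_ofNat]
  refine ⟨?_, ?_, ?_, ?_, ?_, ?_, ?_⟩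
  · linear_combination
      (81 * ζ ^ 20 + 108 * ζ ^ 19 + 135 * ζ ^ 18 + 12 * ζ ^ 17 - 377 * ζ ^ 16 - 456 * ζ ^ 15
      - 489 * ζ ^ 14 - 66 * ζ ^ 13 + 596 * ζ ^ 12 + 624 * ζ ^ 11 + 567 * ζ ^ 10 + 60 * ζ ^ 9
      - 458 * ζ ^ 8 - 270 * ζ ^ 7 - 414 * ζ ^ 6 - 6 * ζ ^ 5 - 2 * ζ ^ 4 - 6 * ζ ^ 3 + 361 *
      ζ ^ 2 + 361) * hΦ
  · linear_combination
      (81 * ζ ^ 20 + 108 * ζ ^ 19 - 189 * ζ ^ 18 - 312 * ζ ^ 17 + 325 * ζ ^ 16 + 504 * ζ ^ 15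
      - 921 * ζ ^ 14 - 1098 * ζ ^ 13 + 1163 * ζ ^ 12 + 1362 * ζ ^ 11 - 1350 * ζ ^ 10 - 1086
      * ζ ^ 9 + 2188 * ζ ^ 8 + 1464 * ζ ^ 7 - 1494 * ζ ^ 6 - 768 * ζ ^ 5 + 1204 * ζ ^ 4 +
      156 * ζ ^ 3 - 1340 * ζ ^ 2 - 552 * ζ + 316) * hΦ
  · linear_combination
      (81 * ζ ^ 20 - 108 * ζ ^ 19 + 135 * ζ ^ 18 - 12 * ζ ^ 17 - 377 * ζ ^ 16 + 456 * ζ ^ 15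
      - 489 * ζ ^ 14 + 66 * ζ ^ 13 + 596 * ζ ^ 12 - 624 * ζ ^ 11 + 567 * ζ ^ 10 - 60 * ζ ^ 9
      - 458 * ζ ^ 8 + 270 * ζ ^ 7 - 414 * ζ ^ 6 + 6 * ζ ^ 5 - 2 * ζ ^ 4 + 6 * ζ ^ 3 + 361 *
      ζ ^ 2 + 361) * hΦ
  · linear_combination
      (81 * ζ ^ 20 - 108 * ζ ^ 19 - 189 * ζ ^ 18 + 312 * ζ ^ 17 + 325 * ζ ^ 16 - 504 * ζ ^ 15
      - 921 * ζ ^ 14 + 1098 * ζ ^ 13 + 1163 * ζ ^ 12 - 1362 * ζ ^ 11 - 1350 * ζ ^ 10 + 1086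
      * ζ ^ 9 + 2188 * ζ ^ 8 - 1464 * ζ ^ 7 - 1494 * ζ ^ 6 + 768 * ζ ^ 5 + 1204 * ζ ^ 4 -
      156 * ζ ^ 3 - 1340 * ζ ^ 2 + 552 * ζ + 316) * hΦ
  · linear_combination
      (ζ ^ 27 + 5 * ζ ^ 26 + 11 * ζ ^ 25 + 10 * ζ ^ 24 - 10 * ζ ^ 23 - 44 * ζ ^ 22 - 60 * ζ ^
      21 - 24 * ζ ^ 20 + 55 * ζ ^ 19 + 115 * ζ ^ 18 + 94 * ζ ^ 17 - 5 * ζ ^ 16 - 106 * ζ ^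
      15 - 125 * ζ ^ 14 - 72 * ζ ^ 13 + 41 * ζ ^ 12 + 138 * ζ ^ 11 + 103 * ζ ^ 10 - 30 * ζ ^
      9 - 123 * ζ ^ 8 - 51 * ζ ^ 7 + 90 * ζ ^ 6 + 195 * ζ ^ 5 + 165 * ζ ^ 4 - 45 * ζ ^ 3 -
      244 * ζ ^ 2 - 240 * ζ - 100) * hΦ
  · linear_combination
      (-9 * ζ ^ 6 - 8 * ζ ^ 4 + 17 * ζ ^ 2 + 17) * hΦ
  · linear_combination
      (-32 * ζ ^ 27 + 160 * ζ ^ 26 - 272 * ζ ^ 25 + 640 * ζ ^ 23 - 848 * ζ ^ 22 + 280 * ζ ^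
      21 + 113 * ζ ^ 20 + 336 * ζ ^ 19 - 232 * ζ ^ 18 - 1530 * ζ ^ 17 + 2748 * ζ ^ 16 - 1494
      * ζ ^ 15 - 40 * ζ ^ 14 - 155 * ζ ^ 13 + 192 * ζ ^ 12 + 1554 * ζ ^ 11 - 3075 * ζ ^ 10 +
      2921 * ζ ^ 9 - 2076 * ζ ^ 8 + 925 * ζ ^ 7 + 315 * ζ ^ 6 - 761 * ζ ^ 5 + 885 * ζ ^ 4 -
      1659 * ζ ^ 3 + 2308 * ζ ^ 2 - 1640 * ζ + 468) * hΦ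
end

section
/- Let β = √(125 + 60√5) and γ = √(250 + 108√5 + (16 + 6√5)β) be real square roots, and set α = (-8 - 3√5 - β + γ)/4 ∈ ℝ. Then α is a root of the polynomial x⁸ + 16x⁷ + 7x⁶ - 22x⁵ - 45x⁴ + 22x³ + 7x² - 16x + 1. -/
/-- Example 1 of the paper: Duke's explicit value
`α = (-8 - 3√5 - √(125+60√5) + √(250 + 108√5 + (16+6√5)√(125+60√5)))/4`
is a root of `x⁸ + 16x⁷ + 7x⁶ - 22x⁵ - 45x⁴ + 22x³ + 7x² - 16x + 1`. -/
theorem duke_value_is_root :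
    let β : ℝ := Real.sqrt (125 + 60 * Real.sqrt 5)
    let γ : ℝ := Real.sqrt (250 + 108 * Real.sqrt 5 + (16 + 6 * Real.sqrt 5) * β)
    let α : ℝ := (-8 - 3 * Real.sqrt 5 - β + γ) / 4
    α ^ 8 + 16 * α ^ 7 + 7 * α ^ 6 - 22 * α ^ 5 - 45 * α ^ 4 + 22 * α ^ 3
      + 7 * α ^ 2 - 16 * α + 1 = 0 := by
  intro β γ α
  have hs : Real.sqrt 5 ^ 2 = 5 := Real.sq_sqrt (by norm_num)
  have hβ : β ^ 2 = 125 + 60 * Real.sqrt 5 := Real.sq_sqrt (by positivity)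
  have hγ : γ ^ 2 = 250 + 108 * Real.sqrt 5 + (16 + 6 * Real.sqrt 5) * β :=
    Real.sq_sqrt (by positivity)
  have hα : 4 * α + 8 + 3 * Real.sqrt 5 + β = γ := by simp only [α]; ring
  clear_value α γ β
  generalize Real.sqrt 5 = s at *
  subst hα
  have quadratic : 2 * α ^ 2 + (8 + 3 * s) * α - 2 = -β * α := by
    linear_combination (hγ - 9 * hs - hβ) / 8
  have quartic : (2 * α ^ 2 + 8 * α - 2) ^ 2 - 80 * α ^ 2
      = -s * (6 * (2 * α ^ 2 + 8 * α - 2) * α - 60 * α ^ 2) := by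
    linear_combination (2 * α ^ 2 + (8 + 3 * s) * α - 2 - β * α) * quadratic
      + α ^ 2 * hβ - 9 * α ^ 2 * hs
  linear_combination
    ((2 * α ^ 2 + 8 * α - 2) ^ 2 - 80 * α ^ 2
      - s * (6 * (2 * α ^ 2 + 8 * α - 2) * α - 60 * α ^ 2)) / 16 * quartic
      + (6 * (2 * α ^ 2 + 8 * α - 2) * α - 60 * α ^ 2) ^ 2 / 16 * hs
end

section
/- Let p be a prime number with p > 5. Then p is representable in the form p = a² + 225·b² with integers a, b if and only if p ≡ 1 (mod 12) and 60 is a fourth power modulo p (i.e., there exists x ∈ ℤ/pℤ with x⁴ = 60). -/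
open ZMod
open scoped NumberTheorySymbols

theorem int_sq_mod_eight (t : ℤ) :
    (t % 4 = 0 ∧ t ^ 2 % 8 = 0) ∨ (t % 4 = 2 ∧ t ^ 2 % 8 = 4) ∨ (t % 2 = 1 ∧ t ^ 2 % 8 = 1) := by
  rcases (by omega : t % 8 = 0 ∨ t % 8 = 1 ∨ t % 8 = 2 ∨ t % 8 = 3 ∨ t % 8 = 4 ∨ t % 8 = 5 ∨
    t % 8 = 6 ∨ t % 8 = 7) with h | h | h | h | h | h | h | h <;>
    simp [Int.mul_emod, pow_two, h] <;> omega

/-- **Thue's lemma** for a prime modulus. -/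
theorem thue_lemma {p : ℕ} (hp : p.Prime) (r : ZMod p) :
    ∃ x y : ℤ, (x ≠ 0 ∨ y ≠ 0) ∧ x ^ 2 < p ∧ y ^ 2 < p ∧ (x : ZMod p) = r * y := by
  have : NeZero p := ⟨hp.ne_zero⟩
  set s := p.sqrt with hs
  have hs1 : p < (s + 1) * (s + 1) := Nat.lt_succ_sqrt p
  have hs2 : s * s < p := by
    refine lt_of_le_of_ne (Nat.sqrt_le p) fun h => ?_
    exact hp.prime.not_isSquare ⟨s, h.symm⟩
  let f : Fin (s + 1) × Fin (s + 1) → ZMod p := fun u => (u.1 : ℕ) - r * (u.2 : ℕ)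
  obtain ⟨u, v, huv, hf⟩ := Fintype.exists_ne_map_eq_of_card_lt f (by simpa [ZMod.card] using hs1)
  have bound : ∀ a b : Fin (s + 1), ((a : ℤ) - (b : ℤ)) ^ 2 < p := by
    intro a b
    have ha := a.2
    have hb := b.2
    have h1 : |((a : ℤ) - (b : ℤ))| ≤ |(s : ℤ)| := by
      rw [abs_le, abs_of_nonneg (by positivity : (0 : ℤ) ≤ s)]
      constructor <;> omega
    have h2 := sq_le_sq.mpr h1
    have h3 : (s : ℤ) * s < p := by exact_mod_cast hs2
    nlinarith
  refine ⟨u.1 - v.1, u.2 - v.2, ?_, bound _ _, bound _ _, ?_⟩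
  · by_contra! h
    apply huv
    ext <;> omega
  · simp only [f] at hf
    push_cast
    linear_combination hf

theorem exists_eq_sq_add_fifteen_mul_sq {p : ℕ} [Fact p.Prime] (h12 : p % 12 = 1)
    (h5 : p % 5 = 1 ∨ p % 5 = 4) {w : ZMod p} (hw : w ^ 2 = -15) :
    ∃ x y : ℤ, (p : ℤ) = x ^ 2 + 15 * y ^ 2 := by
  obtain ⟨x, y, hne, hx, hy, hxy⟩ := thue_lemma (p := p) Fact.out w
  have hdvd : (p : ℤ) ∣ x ^ 2 + 15 * y ^ 2 := by
    rw [← ZMod.intCast_zmod_eq_zero_iff_dvd _ p]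
    push_cast
    rw [hxy]
    linear_combination (y : ZMod p) ^ 2 * hw
  obtain ⟨k, hk⟩ := hdvd
  have hk0 : 0 < k := by
    have : 0 < x ^ 2 + 15 * y ^ 2 := by
      rcases hne with h | h <;> positivity
    rw [hk] at this
    exact pos_of_mul_pos_right this (by positivity)
  have hk16 : k < 16 := by nlinarith
  have hm3 : k % 3 = 0 ∨ k % 3 = 1 := by
    have h1 : (p : ℤ) % 3 = 1 := by omega
    have h2 := congrArg (· % 3) hk
    rcases (by omega : x % 3 = 0 ∨ x % 3 = 1 ∨ x % 3 = 2) with h | h | h <;>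
      simp [Int.add_emod, Int.mul_emod, pow_two, h, h1] at h2 <;> omega
  have hm5 : k % 5 = 0 ∨ k % 5 = 1 ∨ k % 5 = 4 := by
    have h1 : (p : ℤ) % 5 = 1 ∨ (p : ℤ) % 5 = 4 := by omega
    have h2 := congrArg (· % 5) hk
    rcases (by omega : x % 5 = 0 ∨ x % 5 = 1 ∨ x % 5 = 2 ∨ x % 5 = 3 ∨ x % 5 = 4) with
      h | h | h | h | h <;> rcases h1 with h1 | h1 <;>
      simp [Int.add_emod, Int.mul_emod, pow_two, h, h1] at h2 <;> omega
  have dvd_of_sq : ∀ (q : ℕ) (t : ℤ), q.Prime → (q : ℤ) ∣ t ^ 2 → (q : ℤ) ∣ t := fun q t hq h =>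
    (Nat.prime_iff_prime_int.mp hq).dvd_of_dvd_pow h
  have hcases : k = 1 ∨ k = 4 ∨ k = 6 ∨ k = 9 ∨ k = 10 ∨ k = 15 := by omega
  rcases hcases with rfl | rfl | rfl | rfl | rfl | rfl
  · exact ⟨x, y, by linarith⟩
  · have h1 := int_sq_mod_eight x
    have h2 := int_sq_mod_eight y
    obtain ⟨a, rfl⟩ : (2 : ℤ) ∣ x := by omega
    obtain ⟨b, rfl⟩ : (2 : ℤ) ∣ y := by omega
    exact ⟨a, b, by linarith⟩
  · obtain ⟨a, rfl⟩ := dvd_of_sq 3 x (by norm_num) (by omega)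
    have h1 := int_sq_mod_eight a
    have h2 := int_sq_mod_eight y
    push_cast at hk
    ring_nf at hk
    omega
  · obtain ⟨a, rfl⟩ := dvd_of_sq 3 x (by norm_num) (by omega)
    push_cast at hk
    ring_nf at hk
    obtain ⟨b, rfl⟩ := dvd_of_sq 3 y (by norm_num) (by omega)
    exact ⟨a, b, by push_cast at hk; linarith⟩
  · obtain ⟨a, rfl⟩ := dvd_of_sq 5 x (by norm_num) (by omega)
    have h1 := int_sq_mod_eight a
    have h2 := int_sq_mod_eight y
    push_cast at hk
    ring_nf at hk
    omega
  · obtain ⟨a, rfl⟩ := dvd_of_sq 3 x (by norm_num) (by omega)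
    obtain ⟨b, rfl⟩ := dvd_of_sq 5 a (by norm_num) (by push_cast at hk; ring_nf at hk; omega)
    exact ⟨y, b, by push_cast at hk; linarith⟩

theorem isCoprime_of_prime_eq {p : ℕ} (hp : p.Prime) {x y : ℤ} {D : ℤ}
    (hxy : (p : ℤ) = x ^ 2 + D * y ^ 2) : IsCoprime x y := by
  rw [Int.isCoprime_iff_gcd_eq_one, ← Nat.dvd_one]
  by_contra h
  have h1 : Int.gcd x y ≠ 1 := fun h' => h (by rw [h'])
  obtain ⟨q, hq, hqd⟩ := Nat.exists_prime_and_dvd h1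
  obtain ⟨a, rfl⟩ := (Int.natCast_dvd_natCast.mpr hqd).trans (Int.gcd_dvd_left ..)
  obtain ⟨b, rfl⟩ := (Int.natCast_dvd_natCast.mpr hqd).trans (Int.gcd_dvd_right ..)
  have h2 : q * q ∣ p := by
    rw [← Int.natCast_dvd_natCast, hxy]
    exact ⟨a ^ 2 + D * b ^ 2, by push_cast; ring⟩
  have h3 := (Nat.prime_iff.mp hp).squarefree q h2
  exact hq.one_lt.ne' (Nat.isUnit_iff.mp h3)

theorem ZMod.two_ne_zero_of_two_lt {p : ℕ} (h : 2 < p) : (2 : ZMod p) ≠ 0 := by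
  intro h2
  have := Nat.le_of_dvd two_pos ((ZMod.natCast_eq_zero_iff 2 p).mp (by exact_mod_cast h2))
  omega

theorem exists_pow_four_eq_sixty_iff {p : ℕ} [Fact p.Prime] (h4 : p % 4 = 1) {x y : ℤ}
    (hxy : (p : ℤ) = x ^ 2 + 15 * y ^ 2) :
    (∃ z : ZMod p, z ^ 4 = 60) ↔ IsSquare ((x * y : ℤ) : ZMod p) := by
  obtain ⟨j, hj⟩ : IsSquare (-1 : ZMod p) := ZMod.exists_sq_eq_neg_one_iff.mpr (by omega)
  have hp : p.Prime := Fact.out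
  have h2 : (2 : ZMod p) ≠ 0 := ZMod.two_ne_zero_of_two_lt (by have := hp.two_le; omega)
  have hj4 : (1 + j) ^ 4 = -4 := by linear_combination (-j ^ 2 - 4 * j - 5) * hj
  have hj0 : 1 + j ≠ 0 := by
    intro h
    rw [h] at hj4
    exact h2 (pow_eq_zero_iff two_ne_zero |>.mp (by linear_combination hj4 : (2 : ZMod p) ^ 2 = 0))
  have hX : (x : ZMod p) ^ 2 = -15 * y ^ 2 := by
    have := congrArg (Int.cast : ℤ → ZMod p) hxy
    push_cast at this
    rw [CharP.cast_eq_zero] at this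
    linear_combination -this
  have hy : (y : ZMod p) ≠ 0 := by
    intro h
    have hx : (x : ZMod p) = 0 := pow_eq_zero_iff two_ne_zero |>.mp (by rw [hX, h]; ring)
    rw [ZMod.intCast_zmod_eq_zero_iff_dvd] at h hx
    exact (Nat.prime_iff_prime_int.mp hp).not_isUnit
      ((isCoprime_of_prime_eq hp hxy).isUnit_of_dvd' hx h)
  constructor
  · rintro ⟨z, hz⟩
    obtain ⟨t, rfl⟩ : ∃ t, z = (1 + j) * t := ⟨z / (1 + j), by field_simp⟩
    have ht : t ^ 4 = -15 := by
      have : (2 : ZMod p) ^ 2 * (t ^ 4 + 15) = 0 := by linear_combination t ^ 4 * hj4 - hz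
      have := (mul_eq_zero.mp this).resolve_left (pow_ne_zero 2 h2)
      linear_combination this
    have : (x : ZMod p) ^ 2 = (t ^ 2 * y) ^ 2 := by linear_combination hX - y ^ 2 * ht
    push_cast
    rcases sq_eq_sq_iff_eq_or_eq_neg.mp this with h | h
    · exact ⟨t * y, by rw [h]; ring⟩
    · exact ⟨j * t * y, by rw [h]; linear_combination t ^ 2 * y ^ 2 * hj⟩
  · rintro ⟨s, hs⟩
    push_cast at hs
    refine ⟨(1 + j) * (s / y), ?_⟩
    rw [mul_pow, hj4]
    field_simp
    linear_combination (4 * (s ^ 2 + x * y)) * hs - 4 * y ^ 2 * hX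

theorem jacobiSym_eq_one_of_mul_eq_sq_sub {D : ℤ} (n : ℕ) :
    ∀ {l c y : ℤ}, n ≠ 0 → IsCoprime D n → n * l = c ^ 2 - D * y ^ 2 →
      (∀ q : ℕ, q.Prime → (q : ℤ) ∣ n → (q : ℤ) ∣ l → ¬ (q : ℤ) ∣ y) → J(D | n) = 1 := by
  induction n using Nat.strong_induction_on with
  | _ n ih =>
  intro m c y hn hD h hq
  by_cases h1 : n = 1
  · simp [h1]
  obtain ⟨q, hqp, k, rfl⟩ := Nat.exists_prime_and_dvd h1
  have : Fact q.Prime := ⟨hqp⟩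
  have hqi := Nat.prime_iff_prime_int.mp hqp
  have hq0 : (q : ℤ) ≠ 0 := hqi.ne_zero
  have hk0 : k ≠ 0 := right_ne_zero_of_mul hn
  push_cast at h hD hq
  rw [jacobiSym.mul_right' _ hqp.ne_zero hk0]
  have hJ := jacobiSym.eq_one_or_neg_one (Int.isCoprime_iff_gcd_eq_one.mp hD.of_mul_right_left)
  by_cases hqy : (q : ℤ) ∣ y
  · have hqc : (q : ℤ) ∣ c := by
      refine hqi.dvd_of_dvd_pow (n := 2) ?_
      rw [(by linear_combination -h : c ^ 2 = q * (k * m) + D * y * y)]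
      exact dvd_add (dvd_mul_right _ _) (hqy.mul_left _)
    have hqm : ¬ (q : ℤ) ∣ m := fun hm => hq q hqp (dvd_mul_right _ _) hm hqy
    obtain ⟨c, rfl⟩ := hqc
    obtain ⟨y, rfl⟩ := hqy
    have h2 : (k : ℤ) * m = q * (c ^ 2 - D * y ^ 2) :=
      mul_left_cancel₀ hq0 (by linear_combination h)
    obtain ⟨l, rfl⟩ := Int.natCast_dvd_natCast.mp ((hqi.dvd_mul.mp ⟨_, h2⟩).resolve_right hqm)
    have hl0 : l ≠ 0 := right_ne_zero_of_mul hk0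
    push_cast at h2 hD hq
    have hlt : l < q * (q * l) := by
      have := hqp.two_le
      have := Nat.pos_of_ne_zero hl0
      calc l < 2 * l := by omega
        _ ≤ q * l := by gcongr
        _ ≤ q * (q * l) := Nat.le_mul_of_pos_left _ hqp.pos
    have hl := ih l hlt (l := m) (c := c) (y := y) hl0 hD.of_mul_right_right.of_mul_right_right
      (mul_left_cancel₀ hq0 (by linear_combination h2)) fun r hr hrl hrm hry =>
        hq r hr ((hrl.mul_left _).mul_left _) hrm (hry.mul_left _)
    rw [jacobiSym.mul_right' _ hqp.ne_zero hl0, hl]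
    rcases hJ with hJ | hJ <;> simp [hJ]
  · have hJ1 : J(D | q) = 1 := hJ.resolve_right fun hJ => hqy
      (jacobiSym.prime_dvd_of_eq_neg_one hJ (x := c) (y := y) ⟨k * m, by rw [← h]; ring⟩).2
    rw [hJ1, one_mul]
    refine ih k ?_ (l := q * m) (c := c) (y := y) hk0 hD.of_mul_right_right
      (by rw [← h]; ring) ?_
    · nlinarith [hqp.two_le, Nat.pos_of_ne_zero hk0]
    · intro r hr hrk hrm hry
      rcases (Nat.prime_iff_prime_int.mp hr).dvd_mul.mp hrm with h2 | h2
      · obtain rfl := (Nat.prime_dvd_prime_iff_eq hr hqp).mp (Int.natCast_dvd_natCast.mp h2)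
        exact hqy hry
      · exact hq r hr (hrk.mul_left _) h2 hry

theorem jacobiSym_fifteen_natAbs {n : ℤ} (hn : n % 2 = 1) :
    J(15 | n.natAbs) = χ₄ n * J(n | 15) := by
  have h15 : J((15 : ℕ) | n.natAbs) = χ₄ n.natAbs * J(n.natAbs | 15) := by
    rcases (by omega : n.natAbs % 4 = 1 ∨ n.natAbs % 4 = 3) with h | h
    · rw [jacobiSym.quadratic_reciprocity_one_mod_four' (by decide) h, χ₄_nat_one_mod_four h,
        one_mul]
    · rw [jacobiSym.quadratic_reciprocity_three_mod_four (by norm_num) h,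
        χ₄_nat_three_mod_four h, neg_one_mul]
  refine h15.trans ?_
  rcases Int.natAbs_eq n with h | h
  · conv_rhs => rw [h]
    simp
  · conv_rhs => rw [h]
    rw [jacobiSym.neg _ (by decide), Int.cast_neg, ← neg_one_mul ((n.natAbs : ℤ) : ZMod 4), map_mul]
    have h1 : χ₄ (-1) = -1 := by decide
    have h2 : χ₄ ((15 : ℕ) : ZMod 4) = -1 := by decide
    rw [h1, h2, Int.cast_natCast]
    ring

theorem jacobiSym_eq_of_dvd_sub_mul_sq {p : ℕ} (h4 : p % 4 = 1) {n : ℕ} (hn : Odd n)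
    {u a : ℤ} (hu : IsCoprime u n)
    (h : (n : ℤ) ∣ p - a * u ^ 2) : J(n | p) = J(a | n) := by
  rw [← jacobiSym.quadratic_reciprocity_one_mod_four h4 hn, jacobiSym.mod_left' (Int.emod_eq_emod_iff_emod_sub_eq_zero.mpr (Int.emod_eq_zero_of_dvd h)),
    jacobiSym.mul_left, jacobiSym.sq_one' (Int.isCoprime_iff_gcd_eq_one.mp hu), mul_one]

theorem jacobiSym_natAbs_left {p : ℕ} (h4 : p % 4 = 1) (n : ℤ) : J(n.natAbs | p) = J(n | p) := by
  rcases Int.natAbs_eq n with h | h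
  · rw [← h]
  · conv_rhs => rw [h]
    rw [jacobiSym.neg _ (Nat.odd_iff.mpr (by omega)), χ₄_nat_one_mod_four h4, one_mul]

theorem odd_of_sq_add_fifteen_mul_sq {p : ℕ} (h4 : p % 4 = 1) {x y : ℤ}
    (hxy : (p : ℤ) = x ^ 2 + 15 * y ^ 2) : x % 2 = 1 := by
  have hx8 := int_sq_mod_eight x
  have hy8 := int_sq_mod_eight y
  omega

theorem jacobiSym_mul_eq_of_eq_sq_add {p : ℕ} (hp : p.Prime) (h4 : p % 4 = 1)
    {x y : ℤ} (hxy : (p : ℤ) = x ^ 2 + 15 * y ^ 2) :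
    J(x * y | p) = (if y % 4 = 0 then 1 else -1) * J(15 | x.natAbs) := by
  have hcop := isCoprime_of_prime_eq hp hxy
  have hx8 := int_sq_mod_eight x
  have hy8 := int_sq_mod_eight y
  have hp4 : (p : ℤ) % 4 = 1 := by omega
  have hx : x % 2 = 1 := by omega
  have hy : y % 2 = 0 := by omega
  have hy0 : y ≠ 0 := by
    rintro rfl
    refine hp.prime.not_isSquare ⟨x.natAbs, ?_⟩
    zify
    rw [hxy]
    simp [← pow_two]
  have hJx : J(x | p) = J(15 | x.natAbs) := by
    rw [← jacobiSym_natAbs_left h4]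
    refine jacobiSym_eq_of_dvd_sub_mul_sq h4 (Int.natAbs_odd.mpr (Int.odd_iff.mpr hx)) (u := y) ?_ ?_
    · rw [Int.natCast_natAbs]
      exact (hcop.abs_left).symm
    · rw [Int.natCast_natAbs, abs_dvd, hxy]
      exact ⟨x, by ring⟩
  obtain ⟨s, m, hm, hym⟩ := Nat.exists_eq_two_pow_mul_odd (Int.natAbs_ne_zero.mpr hy0)
  have hmy : (m : ℤ) ∣ y := by
    rw [← Int.dvd_natAbs, hym]
    exact ⟨2 ^ s, by push_cast; ring⟩
  have hJm : J(m | p) = 1 := by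
    rw [jacobiSym_eq_of_dvd_sub_mul_sq h4 hm (u := x) (a := 1) (hcop.of_isCoprime_of_dvd_right hmy),
      jacobiSym.one_left]
    rw [hxy]
    exact hmy.trans ⟨15 * y, by ring⟩
  have hJy : J(y | p) = if y % 4 = 0 then 1 else -1 := by
    rw [← jacobiSym_natAbs_left h4, hym]
    push_cast
    rw [jacobiSym.mul_left, hJm, mul_one, jacobiSym.pow_left,
      jacobiSym.at_two (Nat.odd_iff.mpr (by omega)), χ₈_nat_eq_if_mod_eight]
    split_ifs with h1 h2 h3 h4 h5
    · omega
    · omega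
    · simp
    · omega
    · omega
    · have hs : s = 1 := by
        rcases s with _ | _ | s
        · rw [pow_zero, one_mul] at hym
          have := Nat.odd_iff.mp hm
          omega
        · rfl
        · have : 4 ∣ y.natAbs := hym ▸ ⟨2 ^ s * m, by ring⟩
          omega
      simp [hs]
  rw [jacobiSym.mul_left, hJx, hJy, mul_comm]

theorem jacobiSym_fifteen_natAbs_eq {p : ℕ} (hp : p.Prime) (hp5 : 5 < p) {x y c d n m t : ℤ}
    (hxy : (p : ℤ) = x ^ 2 + 15 * y ^ 2) (hcd : (p : ℤ) = c ^ 2 + d ^ 2) (hx : x % 2 = 1)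
    (hn : n % 2 = 1) (hnm : n * m = (x + d) * (x - d)) (hnd : n ∣ x + d) (hmd : m ∣ 2 * (x - d))
    (hnt : n % 15 = t * x % 15) (ht : IsCoprime t 15) :
    J(15 | x.natAbs) = χ₄ x * χ₄ n * J(t | 15) := by
  have hcop := isCoprime_of_prime_eq hp hxy
  have hx15 : IsCoprime x 15 := by
    have h1 : IsCoprime (p : ℤ) (15 : ℕ) := by
      refine Nat.isCoprime_iff_coprime.mpr (hp.coprime_iff_not_dvd.mpr fun h => ?_)
      rcases hp.dvd_mul.mp (show p ∣ 3 * 5 from h) with h | h <;>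
        have := Nat.le_of_dvd (by norm_num) h <;> omega
    rw [hxy] at h1
    exact (IsCoprime.pow_left_iff two_pos).mp (IsCoprime.add_mul_left_left_iff.mp h1)
  have hn15 : IsCoprime n 15 := by
    obtain ⟨k, hk⟩ := Int.dvd_of_emod_eq_zero (Int.emod_eq_emod_iff_emod_sub_eq_zero.mp hnt)
    rw [(by linarith : n = t * x + 15 * k)]
    exact IsCoprime.add_mul_left_left_iff.mpr (ht.mul_left hx15)
  have hn1 : J(15 | n.natAbs) = 1 := by
    refine jacobiSym_eq_one_of_mul_eq_sq_sub n.natAbs (l := n.sign * m) (c := c) (y := y)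
      (by omega) ?_ ?_ ?_
    · rw [Int.natCast_natAbs]
      exact hn15.symm.abs_right
    · rw [← mul_assoc, mul_comm _ n.sign, Int.sign_mul_natAbs]
      linear_combination hnm + hcd - hxy
    · intro q hq hqn hqm hqy
      have hqi := Nat.prime_iff_prime_int.mp hq
      rw [Int.natCast_natAbs, dvd_abs] at hqn
      have hq2 : ¬ (q : ℤ) ∣ 2 := by
        intro h
        have := (Nat.prime_dvd_prime_iff_eq hq Nat.prime_two).mp (by exact_mod_cast h)
        subst this
        push_cast at hqn
        omega
      have hqm' : (q : ℤ) ∣ m := by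
        rcases Int.sign_trichotomy n with h | h | h <;> rw [h] at hqm
        · simpa using hqm
        · rw [Int.sign_eq_zero_iff_zero] at h
          omega
        · simpa using hqm
      have h1 := (hqi.dvd_mul.mp (hqm'.trans hmd)).resolve_left hq2
      have h2 : (q : ℤ) ∣ 2 * x :=
        (by ring : (x + d) + (x - d) = 2 * x) ▸ dvd_add (hqn.trans hnd) h1
      exact hqi.not_isUnit (hcop.isUnit_of_dvd' ((hqi.dvd_mul.mp h2).resolve_left hq2) hqy)
  rw [jacobiSym_fifteen_natAbs hn, jacobiSym.mod_left' (b := 15) hnt, jacobiSym.mul_left] at hn1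
  rw [jacobiSym_fifteen_natAbs hx, mul_assoc]
  congr 1
  rcases jacobiSym.trichotomy x 15 with h | h | h <;> rw [h] at hn1 ⊢
  · simp at hn1
  · linarith
  · linarith

theorem jacobiSym_mul_eq_of_even {p : ℕ} (hp : p.Prime) (hp5 : 5 < p) (h4 : p % 4 = 1)
    {x y c d t : ℤ} (hxy : (p : ℤ) = x ^ 2 + 15 * y ^ 2) (hcd : (p : ℤ) = c ^ 2 + d ^ 2)
    (hd : d % 2 = 0) (hdt : (x + d) % 15 = t * x % 15) (ht : IsCoprime t 15) :
    J(x * y | p) = J(t | 15) := by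
  have hx8 := int_sq_mod_eight x
  have hy8 := int_sq_mod_eight y
  have hc8 := int_sq_mod_eight c
  have hd8 := int_sq_mod_eight d
  have hp4 : (p : ℤ) % 4 = 1 := by omega
  have hx : x % 2 = 1 := by omega
  have hn : (x + d) % 2 = 1 := by omega
  rw [jacobiSym_mul_eq_of_eq_sq_add hp h4 hxy, jacobiSym_fifteen_natAbs_eq hp hp5 hxy hcd hx hn rfl
    dvd_rfl (dvd_mul_left _ _) hdt ht, χ₄_int_eq_if_mod_four, χ₄_int_eq_if_mod_four]
  simp only [hx, hn, one_ne_zero, if_false]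
  split_ifs <;> omega

theorem exists_half_sum_of_sq_add_eq {x y c d : ℤ} (h : x ^ 2 + 15 * y ^ 2 = c ^ 2 + d ^ 2)
    (hx : x % 2 = 1) (hdx : (x - d) % 4 = 0) :
    ∃ n k, x + d = 2 * n ∧ x - d = 4 * k ∧ n % 2 = 1 ∧ (y % 4 = 0 ↔ k % 2 = 0) := by
  have sq_mod_four (t : ℤ) : t ^ 2 % 4 = t % 2 := by
    rcases int_sq_mod_eight t with h | h | h <;> omega
  obtain ⟨n, hn2⟩ : (2 : ℤ) ∣ x + d := by omega
  obtain ⟨k, hk⟩ := Int.dvd_of_emod_eq_zero hdx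
  have hn : n % 2 = 1 := by omega
  refine ⟨n, k, hn2, hk, hn, ?_⟩
  have hprod : 8 * (n * k) = c ^ 2 - 15 * y ^ 2 := by
    have : (x + d) * (x - d) = c ^ 2 - 15 * y ^ 2 := by linear_combination h
    rw [hn2, hk] at this
    linarith
  have hnk : n * k % 2 = k % 2 := by
    rcases Int.emod_two_eq_zero_or_one k with h | h <;> simp [Int.mul_emod, h, hn]
  have hx8 : x ^ 2 % 8 = 1 := by rcases int_sq_mod_eight x with h | h | h <;> omega
  have hd8 : d ^ 2 % 8 = 1 := by rcases int_sq_mod_eight d with h | h | h <;> omega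
  have hcy : c % 2 = 0 ∧ y % 2 = 0 := by
    have hmod : (c ^ 2 - 15 * y ^ 2) % 8 = 0 := by rw [← hprod]; simp
    clear hprod hnk
    have hc := int_sq_mod_eight c
    have hy := int_sq_mod_eight y
    omega
  obtain ⟨a, rfl⟩ : (2 : ℤ) ∣ c := by omega
  obtain ⟨b, rfl⟩ : (2 : ℤ) ∣ y := by omega
  have ha := sq_mod_four a
  have hb := sq_mod_four b
  have hprod' : 2 * (n * k) = a ^ 2 - 15 * b ^ 2 := by linarith
  omega

theorem jacobiSym_mul_eq_of_odd {p : ℕ} (hp : p.Prime) (hp5 : 5 < p) (h4 : p % 4 = 1)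
    {x y c d : ℤ} (hxy : (p : ℤ) = x ^ 2 + 15 * y ^ 2) (hcd : (p : ℤ) = c ^ 2 + d ^ 2)
    (hd : d % 2 = 1) (hd15 : d % 15 = 0) : J(x * y | p) = 1 := by
  have hx : x % 2 = 1 := odd_of_sq_add_fifteen_mul_sq h4 hxy
  wlog hdx : (x - d) % 4 = 0 generalizing d
  · exact this (d := -d) (by linarith) (by omega) (by omega) (by omega)
  obtain ⟨n, k, hn2, hk, hn, hyk⟩ :=
    exists_half_sum_of_sq_add_eq (hxy.symm.trans hcd) hx hdx
  have h8 : J(8 | 15) = 1 := by norm_num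
  have hJ := jacobiSym_fifteen_natAbs_eq (n := n) (t := 8) (m := 2 * (x - d)) hp hp5 hxy hcd hx hn
    (by linear_combination -(x - d) * hn2) ⟨2, by rw [hn2, mul_comm]⟩ dvd_rfl (by omega)
    (by norm_num)
  rw [jacobiSym_mul_eq_of_eq_sq_add hp h4 hxy, hJ, h8, χ₄_int_eq_if_mod_four,
    χ₄_int_eq_if_mod_four]
  have hnx : y % 4 = 0 ↔ n % 4 = x % 4 := by
    clear hxy hcd hJ h8
    omega
  simp only [hx, hn, one_ne_zero, if_false, hnx]
  clear hnx hyk hk hn2 hxy hcd hJ h8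
  split_ifs <;> omega

theorem sq_mod_three (t : ℤ) : (t % 3 = 0 ∧ t ^ 2 % 3 = 0) ∨ (t % 3 ≠ 0 ∧ t ^ 2 % 3 = 1) := by
  rcases (by omega : t % 3 = 0 ∨ t % 3 = 1 ∨ t % 3 = 2) with h | h | h <;>
    simp [Int.mul_emod, pow_two, h]

theorem sq_mod_five (t : ℤ) :
    (t % 5 = 0 ∧ t ^ 2 % 5 = 0) ∨ (t % 5 ≠ 0 ∧ (t ^ 2 % 5 = 1 ∨ t ^ 2 % 5 = 4)) := by
  rcases (by omega : t % 5 = 0 ∨ t % 5 = 1 ∨ t % 5 = 2 ∨ t % 5 = 3 ∨ t % 5 = 4) with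
    h | h | h | h | h <;> simp [Int.mul_emod, pow_two, h]

theorem exists_eq_or_eq_neg_dvd_sub {q x e : ℤ} (hq : Prime q) (h : q ∣ e ^ 2 - x ^ 2) :
    ∃ e', (e' = e ∨ e' = -e) ∧ q ∣ e' - x := by
  rw [sq_sub_sq] at h
  rcases hq.dvd_mul.mp h with h | h
  · exact ⟨-e, .inr rfl, by rw [(by ring : -e - x = -(e + x))]; exact h.neg_right⟩
  · exact ⟨e, .inl rfl, h⟩

theorem jacobiSym_mul_eq_one {p : ℕ} (hp : p.Prime) (hp5 : 5 < p) (h4 : p % 4 = 1)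
    {x y a b : ℤ} (hxy : (p : ℤ) = x ^ 2 + 15 * y ^ 2) (hab : (p : ℤ) = a ^ 2 + 225 * b ^ 2) :
    J(x * y | p) = 1 := by
  have hcd : (p : ℤ) = a ^ 2 + (15 * b) ^ 2 := by linarith
  rcases Int.emod_two_eq_zero_or_one (15 * b) with h | h
  · rw [jacobiSym_mul_eq_of_even (t := 1) hp hp5 h4 hxy hcd h (by omega) isCoprime_one_left,
      jacobiSym.one_left]
  · exact jacobiSym_mul_eq_of_odd hp hp5 h4 hxy hcd h (by omega)

theorem jacobiSym_mul_eq_neg_one {p : ℕ} (hp : p.Prime) (hp5 : 5 < p) (h4 : p % 4 = 1)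
    {x y c d : ℤ} (hxy : (p : ℤ) = x ^ 2 + 15 * y ^ 2)
    (hcd : (p : ℤ) = (3 * c) ^ 2 + (5 * d) ^ 2) : J(x * y | p) = -1 := by
  have hpar : (3 * c) % 2 = 0 ∨ (5 * d) % 2 = 0 := by
    have hc8 := int_sq_mod_eight (3 * c)
    have hd8 := int_sq_mod_eight (5 * d)
    omega
  rcases hpar with h | h
  · obtain ⟨e, he, hex⟩ := exists_eq_or_eq_neg_dvd_sub (Nat.prime_iff_prime_int.mp Nat.prime_five) (e := 3 * c) (x := x)
      ⟨3 * y ^ 2 - 5 * d ^ 2, by push_cast; linear_combination hxy - hcd⟩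
    have hce : (p : ℤ) = (5 * d) ^ 2 + e ^ 2 := by rcases he with rfl | rfl <;> linarith
    rw [jacobiSym_mul_eq_of_even (t := 7) hp hp5 h4 hxy hce (by omega) (by omega) (by norm_num)]
    norm_num
  · obtain ⟨e, he, hex⟩ := exists_eq_or_eq_neg_dvd_sub Int.prime_three (e := 5 * d) (x := x)
      ⟨5 * y ^ 2 - 3 * c ^ 2, by linear_combination hxy - hcd⟩
    have hce : (p : ℤ) = (3 * c) ^ 2 + e ^ 2 := by rcases he with rfl | rfl <;> linarith
    rw [jacobiSym_mul_eq_of_even (t := 11) hp hp5 h4 hxy hce (by omega) (by omega) (by norm_num)]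
    norm_num

/-- By genus theory, a prime `p ≡ 1 mod 12` with `p ≡ ±1 mod 5` is `a² + 225 b²` or
`9 a² + 25 b²`. -/
theorem eq_sq_add_or_eq_sq_add {p : ℕ} [Fact p.Prime] (h12 : p % 12 = 1)
    (h5 : p % 5 = 1 ∨ p % 5 = 4) :
    (∃ a b : ℤ, (p : ℤ) = a ^ 2 + 225 * b ^ 2) ∨
      ∃ a b : ℤ, (p : ℤ) = (3 * a) ^ 2 + (5 * b) ^ 2 := by
  obtain ⟨c, d, hcd⟩ := Nat.Prime.sq_add_sq (p := p) (by omega)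
  have hcd' : (p : ℤ) = (c : ℤ) ^ 2 + (d : ℤ) ^ 2 := by exact_mod_cast hcd.symm
  generalize (c : ℤ) = c at hcd'
  generalize (d : ℤ) = d at hcd'
  have h3 : c % 3 = 0 ∨ d % 3 = 0 := by
    have := sq_mod_three c
    have := sq_mod_three d
    omega
  have h5 : c % 5 = 0 ∨ d % 5 = 0 := by
    have := sq_mod_five c
    have := sq_mod_five d
    omega
  rcases h3 with h3 | h3 <;> rcases h5 with h5 | h5
  · obtain ⟨k, rfl⟩ : (15 : ℤ) ∣ c := by omega
    exact .inl ⟨d, k, by linarith⟩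
  · obtain ⟨k, rfl⟩ : (3 : ℤ) ∣ c := by omega
    obtain ⟨l, rfl⟩ : (5 : ℤ) ∣ d := by omega
    exact .inr ⟨k, l, hcd'⟩
  · obtain ⟨k, rfl⟩ : (3 : ℤ) ∣ d := by omega
    obtain ⟨l, rfl⟩ : (5 : ℤ) ∣ c := by omega
    exact .inr ⟨k, l, by linarith⟩
  · obtain ⟨k, rfl⟩ : (15 : ℤ) ∣ d := by omega
    exact .inl ⟨c, k, by linarith⟩

theorem isSquare_neg_fifteen_iff {p : ℕ} [Fact p.Prime] (h12 : p % 12 = 1) (h5 : p % 5 ≠ 0) :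
    IsSquare (-15 : ZMod p) ↔ p % 5 = 1 ∨ p % 5 = 4 := by
  have hJ : J(-15 | p) = J((p % 15 : ℕ) | 15) := by
    have h := jacobiSym.quadratic_reciprocity_one_mod_four' (a := 15) (by decide)
      (by omega : p % 4 = 1)
    rw [jacobiSym.neg _ (Nat.odd_iff.mpr (by omega)), χ₄_nat_one_mod_four (by omega), one_mul]
    refine h.trans (jacobiSym.mod_left _ _)
  have hsq := (ZMod.nonsquare_iff_jacobiSym_eq_neg_one (p := p) (a := -15)).not
  rw [not_not, hJ] at hsq
  push_cast at hsq
  rw [← hsq]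
  rcases (by omega : p % 15 = 1 ∨ p % 15 = 4 ∨ p % 15 = 7 ∨ p % 15 = 13) with h | h | h | h <;>
    zify at h <;> rw [h] <;> norm_num <;> omega

/-- Corollary from Example 2 of the paper: a prime `p > 5` is representable as
`p = a² + 225b²` if and only if `p ≡ 1 (mod 12)` and `60` is a fourth power
modulo `p`. -/
theorem prime_repr_a_sq_add_225_b_sq (p : ℕ) (hp : p.Prime) (hp5 : 5 < p) :
    (∃ a b : ℤ, (p : ℤ) = a ^ 2 + 225 * b ^ 2) ↔
      (p % 12 = 1 ∧ ∃ x : ZMod p, x ^ 4 = 60) := by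
  have : Fact p.Prime := ⟨hp⟩
  have hp0 : p % 5 ≠ 0 := fun h => by
    have := (Nat.prime_dvd_prime_iff_eq Nat.prime_five hp).mp (Nat.dvd_of_mod_eq_zero h)
    omega
  have exists_rep (h12 : p % 12 = 1) (h5 : p % 5 = 1 ∨ p % 5 = 4) :
      ∃ x y : ℤ, (p : ℤ) = x ^ 2 + 15 * y ^ 2 ∧
        ((∃ z : ZMod p, z ^ 4 = 60) ↔ J(x * y | p) ≠ -1) := by
    obtain ⟨w, hw⟩ := (isSquare_neg_fifteen_iff h12 hp0).mpr h5
    obtain ⟨x, y, hxy⟩ := exists_eq_sq_add_fifteen_mul_sq h12 h5 (w := w) (by rw [hw, pow_two])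
    refine ⟨x, y, hxy, ?_⟩
    rw [exists_pow_four_eq_sixty_iff (by omega) hxy, ne_eq,
      ZMod.nonsquare_iff_jacobiSym_eq_neg_one, not_not]
  constructor
  · rintro ⟨a, b, hab⟩
    have h2 : p % 2 = 1 := hp.eq_two_or_odd.resolve_left (by omega)
    have h4 : p % 4 = 1 := by
      have := int_sq_mod_eight a
      have := int_sq_mod_eight b
      omega
    have h3 : p % 3 = 1 := by
      have h3 : p % 3 ≠ 0 := fun h => by
        have := (Nat.prime_dvd_prime_iff_eq Nat.prime_three hp).mp (Nat.dvd_of_mod_eq_zero h)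
        omega
      have := sq_mod_three a
      omega
    have h5 : p % 5 = 1 ∨ p % 5 = 4 := by
      have := sq_mod_five a
      omega
    have h12 : p % 12 = 1 := by omega
    obtain ⟨x, y, hxy, h⟩ := exists_rep h12 h5
    refine ⟨h12, h.mpr ?_⟩
    rw [jacobiSym_mul_eq_one hp hp5 h4 hxy hab]
    norm_num
  · rintro ⟨h12, hz⟩
    have h5 : p % 5 = 1 ∨ p % 5 = 4 := by
      rw [← isSquare_neg_fifteen_iff h12 hp0]
      obtain ⟨z, hz⟩ := hz
      have h2 := ZMod.two_ne_zero_of_two_lt (by omega : 2 < p)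
      have h15 : IsSquare (15 : ZMod p) := by
        refine ⟨z ^ 2 / 2, ?_⟩
        field_simp
        linear_combination -hz
      have := (ZMod.exists_sq_eq_neg_one_iff.mpr (by omega : p % 4 ≠ 3)).mul h15
      rwa [neg_one_mul] at this
    obtain ⟨x, y, hxy, h⟩ := exists_rep h12 h5
    refine (eq_sq_add_or_eq_sq_add h12 h5).resolve_right ?_
    rintro ⟨c, d, hcd⟩
    exact h.mp hz (jacobiSym_mul_eq_neg_one hp hp5 (by omega) hxy hcd)
end
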